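/- arXiv:1403.2618 — 8 statements merged into one kernel-verified Lean document; each statement's English description precedes it below -/
import Mathlib

section
/- Let E and F be real vector spaces, with F non-degenerate (for every nonzero v ∈ F there is a linear functional λ : F → ℝ with λ(v) ≠ 0). Let A and B be symmetric multilinear maps of rank r from E^r to F. If the function x ↦ A(x,...,x) − B(x,...,x) is constant on a subset U of E whose r-fold iterated star Star^r(U,E) is non-empty, then A = B. -/
/-- The star of a subset `U` of a real vector space `E`: the set of points `v ∈ U` such that
for every `w ∈ E` there is `δ > 0` with `v + t • w ∈ U` whenever `|t| ≤ δ`. -/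
def starSet {E : Type*} [AddCommGroup E] [Module ℝ E] (U : Set E) : Set E :=
  {v ∈ U | ∀ w : E, ∃ δ : ℝ, 0 < δ ∧ ∀ t : ℝ, |t| ≤ δ → v + t • w ∈ U}

/-- The `r`-fold iterated star: `Star^1(U,E) = Star(U,E)` and
`Star^r(U,E) = Star^{r-1}(Star(U,E),E)`. -/
def starIter {E : Type*} [AddCommGroup E] [Module ℝ E] : ℕ → Set E → Set E
  | 0, U => U
  | (k + 1), U => starIter k (starSet U)

theorem starIter_mono_aux {E : Type*} [AddCommGroup E] [Module ℝ E] (k : ℕ) (U : Set E) :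
    starIter k U ⊆ U := by
  induction k generalizing U with
  | zero => exact fun x hx => hx
  | succ k ih => exact fun x hx => (ih (starSet U) hx).1

theorem diag_zero_aux {E : Type*} [AddCommGroup E] [Module ℝ E] {r : ℕ} (hr : 1 ≤ r)
    (g : MultilinearMap ℝ (fun _ : Fin r => E) ℝ) (v w : E) (c δ : ℝ) (hδ : 0 < δ)
    (h : ∀ t : ℝ, |t| ≤ δ → g (fun _ => v + t • w) = c) : g (fun _ => w) = 0 := by
  classical
  let P : Polynomial ℝ := ∑ s : Finset (Fin r),
    Polynomial.C (g (s.piecewise (fun _ => v) (fun _ => w))) * Polynomial.X ^ (sᶜ.card)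
  have hP : ∀ t : ℝ, P.eval t = g (fun _ => v + t • w) := by
    intro t
    have h1 := g.map_add_univ (fun _ => v) (fun _ => t • w)
    have h2 : ((fun _ => v) + (fun _ => t • w) : Fin r → E) = fun _ => v + t • w := rfl
    rw [h2] at h1
    rw [h1]
    simp only [P, Polynomial.eval_finsetSum, Polynomial.eval_mul, Polynomial.eval_C,
      Polynomial.eval_pow, Polynomial.eval_X]
    refine Finset.sum_congr rfl fun s _ => ?_
    have h3 := g.map_smul_univ (fun i => if i ∈ s then 1 else t)
      (s.piecewise (fun _ => v) (fun _ => w))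
    have h4 : (fun i => (if i ∈ s then (1:ℝ) else t) •
        (s.piecewise (fun _ => v) (fun _ => w) : Fin r → E) i)
        = s.piecewise (fun _ => v) (fun _ => t • w) := by
      funext i
      by_cases hi : i ∈ s <;> simp [hi]
    have h5 : (∏ i, if i ∈ s then (1:ℝ) else t) = t ^ (sᶜ.card) := by
      rw [Finset.prod_ite]
      simp only [Finset.prod_const_one, one_mul, Finset.prod_const]
      congr 2
      ext i
      simp
    rw [h4, h5] at h3
    rw [h3, smul_eq_mul, mul_comm]
  have hPc : P = Polynomial.C c := by
    refine Polynomial.eq_of_infinite_eval_eq _ _ ((Set.Icc_infinite hδ).mono ?_)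
    intro t ht
    simp only [Set.mem_ofPred_eq, Polynomial.eval_C, hP]
    exact h t (by rw [abs_of_nonneg ht.1]; exact ht.2)
  have h6 : P.coeff r = 0 := by
    rw [hPc, Polynomial.coeff_C, if_neg (by omega)]
  simp only [P, Polynomial.finsetSum_coeff, Polynomial.coeff_C_mul, Polynomial.coeff_X_pow] at h6
  rw [Finset.sum_eq_single ∅] at h6
  · simpa using h6
  · intro s _ hs
    have h7 : r ≠ sᶜ.card := by
      intro h8
      apply hs
      have := Finset.card_compl_add_card s
      rw [Fintype.card_fin] at this
      exact Finset.card_eq_zero.mp (by omega)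
    simp [h7]
  · simp

theorem polar_aux {E : Type*} [AddCommGroup E] [Module ℝ E] {r : ℕ}
    (g : MultilinearMap ℝ (fun _ : Fin r => E) ℝ)
    (hsym : ∀ (σ : Equiv.Perm (Fin r)) (v : Fin r → E), g (v ∘ σ) = g v)
    (h : ∀ w : E, g (fun _ => w) = 0) (v : Fin r → E) : g v = 0 := by
  classical
  let P : MvPolynomial (Fin r) ℝ := ∑ p : Fin r → Fin r,
    MvPolynomial.monomial (∑ i, Finsupp.single (p i) 1) (g (v ∘ p))
  have hP : P = 0 := by
    apply MvPolynomial.funext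
    intro x
    have h1 := g.map_sum (fun _ j => x j • v j)
    rw [h (∑ j, x j • v j)] at h1
    rw [map_zero, h1]
    simp only [P, map_sum]
    refine Finset.sum_congr rfl fun p _ => ?_
    rw [g.map_smul_univ (fun i => x (p i)) (fun i => v (p i)), MvPolynomial.monomial_sum_index]
    simp [Function.comp_def, mul_comm, MvPolynomial.eval_monomial]
  have h2 : P.coeff (∑ i, Finsupp.single i 1) = 0 := by rw [hP]; simp
  simp only [P, MvPolynomial.coeff_sum, MvPolynomial.coeff_monomial] at h2
  have h3 : ∀ p : Fin r → Fin r,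
      (if (∑ i, Finsupp.single (p i) 1 : Fin r →₀ ℕ) = ∑ i, Finsupp.single i 1
        then g (v ∘ p) else 0) = if Function.Bijective p then g v else 0 := by
    intro p
    have h4 : (∑ i, Finsupp.single (p i) 1 : Fin r →₀ ℕ) = ∑ i, Finsupp.single i 1 ↔
        Function.Bijective p := by
      constructor
      · intro h5
        rw [← Finite.surjective_iff_bijective]
        intro j
        by_contra! h6
        have := DFunLike.congr_fun h5 j
        simp [Finsupp.finsetSum_apply, Finsupp.single_apply, h6] at this
      · intro h5
        exact h5.sum_comp (fun i => (Finsupp.single i 1 : Fin r →₀ ℕ))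
    by_cases h5 : Function.Bijective p
    · rw [if_pos (h4.2 h5), if_pos h5]
      exact hsym (Equiv.ofBijective p h5) v
    · rw [if_neg (fun h6 => h5 (h4.1 h6)), if_neg h5]
  rw [Finset.sum_congr rfl (fun p _ => h3 p), ← Finset.sum_filter, Finset.sum_const,
    nsmul_eq_mul] at h2
  rcases mul_eq_zero.1 h2 with h5 | h5
  · exfalso
    rw [Nat.cast_eq_zero, Finset.card_eq_zero] at h5
    have : (id : Fin r → Fin r) ∈ Finset.univ.filter
      (fun p : Fin r → Fin r => Function.Bijective p) := by
      exact Finset.mem_filter.2 ⟨Finset.mem_univ _, Function.bijective_id⟩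
    rw [h5] at this
    simp at this
  · exact h5

/-- Let `E` and `F` be real vector spaces with `F` non-degenerate. If `A` and
`B` are symmetric multilinear maps of rank `r` from `E^r` to `F` and the monomial function
`x ↦ A(x,…,x) − B(x,…,x)` is constant on a subset `U` of `E` whose `r`-fold iterated star is
non-empty, then `A = B`. -/
theorem monomial_constant_on_star_imp_eq
    {E F : Type*} [AddCommGroup E] [Module ℝ E] [AddCommGroup F] [Module ℝ F]
    (hF : ∀ v : F, v ≠ 0 → ∃ l : F →ₗ[ℝ] ℝ, l v ≠ 0)
    {r : ℕ} (hr : 1 ≤ r)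
    (A B : MultilinearMap ℝ (fun _ : Fin r => E) F)
    (hAsym : ∀ (σ : Equiv.Perm (Fin r)) (v : Fin r → E), A (v ∘ σ) = A v)
    (hBsym : ∀ (σ : Equiv.Perm (Fin r)) (v : Fin r → E), B (v ∘ σ) = B v)
    (U : Set E) (hstar : (starIter r U).Nonempty)
    (c : F) (hconst : ∀ x ∈ U, A (fun _ => x) - B (fun _ => x) = c) :
    A = B := by
  obtain ⟨v, hv⟩ := hstar
  obtain ⟨k, rfl⟩ : ∃ k, r = k + 1 := ⟨r - 1, by omega⟩
  have hv1 : v ∈ starSet U := starIter_mono_aux k (starSet U) hv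
  ext m
  by_contra hne
  obtain ⟨l, hl⟩ := hF (A m - B m) (sub_ne_zero.2 hne)
  apply hl
  refine polar_aux (l.compMultilinearMap (A - B)) ?_ ?_ m
  · intro σ x
    simp [hAsym, hBsym]
  · intro w
    obtain ⟨δ, hδ, hU⟩ := hv1.2 w
    refine diag_zero_aux hr _ v w (l c) δ hδ fun t ht => ?_
    rw [← hconst _ (hU t ht)]
    rfl
end

section
/- Let E be a real vector space and F a non-degenerate real vector space (for every nonzero v ∈ F there is a linear functional λ : F → ℝ with λ(v) ≠ 0). Let A be a symmetric multilinear map of rank r ≥ 1 from E^r to F, and suppose the monomial function f_A(x) = A(x,...,x) is constant on a subset U of E. Then for every v₀ ∈ Star(U,E) and every w ∈ E, the value A(v₀, ..., v₀, w) (with v₀ repeated r−1 times) is zero. -/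
/-- Let `E` be a real vector space and `F` a non-degenerate real vector space.
If `A` is a symmetric multilinear map of rank `r ≥ 1` from `E^r` to `F` whose monomial function
`x ↦ A(x,…,x)` is constant on a subset `U` of `E`, then for every `v₀ ∈ Star(U,E)` and every
`w ∈ E`, we have `A(v₀,…,v₀,w) = 0` (`v₀` repeated `r − 1` times). -/
theorem symm_multilinear_top_coefficient_vanishes
    {E F : Type*} [AddCommGroup E] [Module ℝ E] [AddCommGroup F] [Module ℝ F]
    (hF : ∀ v : F, v ≠ 0 → ∃ l : F →ₗ[ℝ] ℝ, l v ≠ 0)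
    {r : ℕ} (hr : 1 ≤ r)
    (A : MultilinearMap ℝ (fun _ : Fin r => E) F)
    (hAsym : ∀ (σ : Equiv.Perm (Fin r)) (v : Fin r → E), A (v ∘ σ) = A v)
    (U : Set E) (c : F) (hconst : ∀ x ∈ U, A (fun _ => x) = c) :
    ∀ v₀ ∈ starSet U, ∀ w : E,
      A (fun i => if (i : ℕ) < r - 1 then v₀ else w) = 0 := by
  classical
  intro v₀ hv w
  by_contra hne
  obtain ⟨l, hl⟩ := hF _ hne
  obtain ⟨-, hstar⟩ := hv
  obtain ⟨δ, hδ, hU⟩ := hstar w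
  set β : ℝ := l (A (fun i => if (i : ℕ) < r - 1 then v₀ else w)) with hβ
  let b : Finset (Fin r) → ℝ := fun s => l (A (s.piecewise (fun _ => w) (fun _ => v₀)))
  have hb : ∀ s : Finset (Fin r), s.card = 1 → b s = β := by
    intro s hs
    obtain ⟨i, rfl⟩ := Finset.card_eq_one.mp hs
    let m : Fin r := ⟨r - 1, by omega⟩
    simp only [b, hβ]
    congr 1
    rw [← hAsym (Equiv.swap i m)]
    congr 1
    funext j
    have h1 : (Equiv.swap i m) j = i ↔ j = m := by
      rw [Equiv.swap_apply_eq_iff, Equiv.swap_apply_left]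
    have h2 : j = m ↔ ¬ ((j : ℕ) < r - 1) := by
      rw [Fin.ext_iff]
      have := j.isLt
      simp only [m]
      omega
    by_cases hj : (j : ℕ) < r - 1
    · have : ¬ (Equiv.swap i m) j = i := by rw [h1, h2]; exact not_not.mpr hj
      simp [Finset.piecewise, hj, this]
    · have : (Equiv.swap i m) j = i := by rw [h1, h2]; exact hj
      simp [Finset.piecewise, hj, this]
  have hexp : ∀ t : ℝ, l (A (fun _ => v₀ + t • w)) = ∑ s : Finset (Fin r), b s * t ^ s.card := by
    intro t
    have h0 : (fun _ : Fin r => v₀ + t • w) = (fun _ => t • w) + (fun _ => v₀) := by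
      funext i
      simp [add_comm]
    rw [h0, A.map_add_univ, map_sum]
    refine Finset.sum_congr rfl fun s _ => ?_
    have h1 : s.piecewise (fun _ : Fin r => t • w) (fun _ => v₀) =
        s.piecewise (fun i => (fun _ : Fin r => t) i •
          (s.piecewise (fun _ : Fin r => w) (fun _ => v₀)) i)
          (s.piecewise (fun _ : Fin r => w) (fun _ => v₀)) := by
      funext i
      by_cases hi : i ∈ s <;> simp [hi]
    rw [h1, A.map_piecewise_smul]
    simp [b, mul_comm]
  let P : Polynomial ℝ :=
    ∑ s : Finset (Fin r), Polynomial.C (b s) * Polynomial.X ^ s.card - Polynomial.C (l c)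
  have hP : P = 0 := by
    apply Polynomial.eq_zero_of_infinite_isRoot
    refine (Set.Icc_infinite (show (0 : ℝ) < δ from hδ)).mono ?_
    intro t ht
    have h := hexp t
    rw [hconst _ (hU t (by rw [abs_of_nonneg ht.1]; exact ht.2))] at h
    simp [P, Polynomial.IsRoot, Polynomial.eval_finsetSum, h]
  have hc : P.coeff 1 = (r : ℝ) * β := by
    have h1 : ∀ s : Finset (Fin r), (Polynomial.C (b s) * Polynomial.X ^ s.card).coeff 1
        = if s.card = 1 then β else 0 := by
      intro s
      rw [Polynomial.coeff_C_mul_X_pow]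
      by_cases h : s.card = 1
      · simp [h, hb s h]
      · simp [h, Ne.symm h]
    simp only [P, Polynomial.coeff_sub, Polynomial.finsetSum_coeff, h1, Polynomial.coeff_C]
    rw [← Finset.sum_filter, Finset.sum_const]
    have h2 : (Finset.univ.filter fun s : Finset (Fin r) => s.card = 1).card = r := by
      have := Fintype.card_finset_len (α := Fin r) 1
      rw [Fintype.card_subtype] at this
      simpa using this
    rw [h2]
    simp
  rw [hP] at hc
  have hr' : (r : ℝ) ≠ 0 := by
    have : r ≠ 0 := by omega
    exact_mod_cast this
  exact (mul_ne_zero hr' hl) (by simpa using hc.symm)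
end

section
/- (Observer Principle) Let F be a real vector space, let n ≥ 1, and let η be the Minkowski form on ℝ^{n+1}. Let A and B be symmetric multilinear maps of rank r from (ℝ^{n+1})^r to F. If A(u,...,u) = B(u,...,u) for every timelike unit vector u (i.e., every u with η(u,u) = −1), then A = B. -/
/-- The Minkowski form on `ℝ^{n+1}`: `η(v,w) = −v₀·w₀ + ∑_{i=1}^{n} v_i·w_i`. -/
def minkowski (n : ℕ) (v w : Fin (n + 1) → ℝ) : ℝ :=
  -(v 0 * w 0) + ∑ i : Fin n, v i.succ * w i.succ

/-- A real multilinear form on a finite power of `ℝ^m` is continuous. -/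
theorem multilinear_form_continuous {m r : ℕ}
    (C : MultilinearMap ℝ (fun _ : Fin r => (Fin m → ℝ)) ℝ) : Continuous C := by
  have hC : (C : (Fin r → (Fin m → ℝ)) → ℝ) = fun v => ∑ j : Fin r → Fin m,
      (∏ i, v i (j i)) • C (fun i => Pi.single (j i) (1 : ℝ)) := by
    funext v
    have hv : v = fun i => ∑ k : Fin m, v i k • (Pi.single k (1 : ℝ) : Fin m → ℝ) := by
      funext i
      exact pi_eq_sum_univ' (v i)
    conv_lhs => rw [hv]
    rw [C.map_sum]
    exact Finset.sum_congr rfl fun j _ => C.map_smul_univ _ _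
  rw [hC]
  fun_prop

/-- **Observer Principle.** Let `F` be a real vector space and `A`, `B`
symmetric multilinear maps of rank `r` on Minkowski space `ℝ^{n+1}` (`n ≥ 1`) with values
in `F`.  If `A(u,…,u) = B(u,…,u)` for every timelike unit vector `u` (i.e. `η(u,u) = −1`),
then `A = B`. -/
theorem observer_principle
    {F : Type*} [AddCommGroup F] [Module ℝ F]
    {n : ℕ} (hn : 1 ≤ n) {r : ℕ}
    (A B : MultilinearMap ℝ (fun _ : Fin r => (Fin (n + 1) → ℝ)) F)
    (hAsym : ∀ (σ : Equiv.Perm (Fin r)) (v : Fin r → (Fin (n + 1) → ℝ)), A (v ∘ σ) = A v)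
    (hBsym : ∀ (σ : Equiv.Perm (Fin r)) (v : Fin r → (Fin (n + 1) → ℝ)), B (v ∘ σ) = B v)
    (h : ∀ u : Fin (n + 1) → ℝ, minkowski n u u = -1 →
      A (fun _ => u) = B (fun _ => u)) :
    A = B := by
  rw [← sub_eq_zero]
  refine MultilinearMap.ext fun v => ?_
  rw [MultilinearMap.zero_apply]
  rw [← Module.forall_dual_apply_eq_zero_iff ℝ]
  intro φ
  let C : MultilinearMap ℝ (fun _ : Fin r => (Fin (n + 1) → ℝ)) ℝ :=
    φ.compMultilinearMap (A - B)
  have hCsym : ∀ (σ : Equiv.Perm (Fin r)), C (fun i => v (σ i)) = C v := by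
    intro σ
    have h1 := hAsym σ v
    have h2 := hBsym σ v
    simp only [Function.comp_def] at h1 h2
    simp [C, h1, h2]
  have hcont : Continuous C := multilinear_form_continuous C
  let D : ContinuousMultilinearMap ℝ (fun _ : Fin r => (Fin (n + 1) → ℝ)) ℝ := ⟨C, hcont⟩
  let e : Fin (n + 1) → ℝ := Pi.single 0 1
  have hmc : Continuous (fun u => minkowski n u u) := by
    unfold minkowski
    fun_prop
  have he : minkowski n e e < 0 := by
    simp [minkowski, e]
  have hev : (fun u => D (fun _ => u)) =ᶠ[nhds e] (fun _ => (0 : ℝ)) := by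
    filter_upwards [hmc.continuousAt.eventually_lt_const he] with u hu
    change C (fun _ => u) = 0
    set m := - minkowski n u u with hm
    have hmpos : 0 < m := by linarith
    have hs : 0 < Real.sqrt m := Real.sqrt_pos.mpr hmpos
    have hss : Real.sqrt m * Real.sqrt m = m := Real.mul_self_sqrt hmpos.le
    have hsc : ∀ c : ℝ, minkowski n (c • u) (c • u) = c * c * minkowski n u u := by
      intro c
      simp only [minkowski, Pi.smul_apply, smul_eq_mul, mul_add, Finset.mul_sum]
      congr 1
      · ring
      · exact Finset.sum_congr rfl fun i _ => by ring
    have h1 : minkowski n ((Real.sqrt m)⁻¹ • u) ((Real.sqrt m)⁻¹ • u) = -1 := by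
      rw [hsc, ← mul_inv, hss, show minkowski n u u = - m by simp [hm]]
      field_simp
    have h2 := h _ h1
    have h3 : C (fun _ => (Real.sqrt m)⁻¹ • u) = 0 := by simp [C, h2]
    have h4 := C.map_smul_univ (fun _ => (Real.sqrt m)⁻¹) (fun _ => u)
    rw [h3] at h4
    have h5 : (∏ _i : Fin r, (Real.sqrt m)⁻¹) ≠ 0 :=
      Finset.prod_ne_zero_iff.mpr fun _ _ => inv_ne_zero hs.ne'
    exact (smul_eq_zero.mp h4.symm).resolve_left h5
  have key := D.iteratedFDeriv_comp_diagonal e v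
  rw [(hev.iteratedFDeriv ℝ r).eq_of_nhds] at key
  have hz : iteratedFDeriv ℝ r (fun _ : Fin (n + 1) → ℝ => (0 : ℝ)) e v = 0 := by
    simp
  rw [hz] at key
  have hsum : ∑ σ : Equiv.Perm (Fin r), D (fun i => v (σ i))
      = ∑ _σ : Equiv.Perm (Fin r), C v := Finset.sum_congr rfl fun σ _ => hCsym σ
  rw [hsum, Finset.sum_const, nsmul_eq_mul] at key
  have hcard : ((Finset.univ : Finset (Equiv.Perm (Fin r))).card : ℝ) ≠ 0 := by
    simp [Finset.card_univ, Fintype.card_perm, Nat.factorial_ne_zero]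
  exact (mul_eq_zero.mp key.symm).resolve_left hcard
end

section
/- Let F be a real vector space, let n ≥ 1, and let η be the Minkowski form on ℝ^{n+1}. Let A and B be symmetric multilinear maps of rank r from (ℝ^{n+1})^r to F. If A(u,...,u) = B(u,...,u) for every future-pointing timelike unit vector u (i.e., every u with η(u,u) = −1 and u₀ > 0), then A = B. -/
open Finset in
lemma obs_alt {r : ℕ} (f : Fin r → Fin r) (hf : ¬ Function.Bijective f) :
    ∑ S : Finset (Fin r), (if ∀ j, f j ∈ S then (-1 : ℝ) ^ #S else 0) = 0 := by
  classical
  have hs : ¬ Function.Surjective f := fun hs => hf (Finite.surjective_iff_bijective.1 hs)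
  obtain ⟨i, hi⟩ := not_forall.1 hs
  have hi' : ∀ j, f j ≠ i := fun j hj => hi ⟨j, hj⟩
  have key : ∀ S : Finset (Fin r), i ∉ S →
      (if ∀ j, f j ∈ insert i S then (-1 : ℝ) ^ #(insert i S) else 0)
        = - (if ∀ j, f j ∈ S then (-1 : ℝ) ^ #S else 0) := by
    intro S hS
    simp only [mem_insert, hi', false_or, card_insert_of_notMem hS]
    split_ifs <;> ring
  refine Finset.sum_involution (fun S _ => if i ∈ S then S.erase i else insert i S) ?_ ?_ ?_ ?_
  · intro S _
    by_cases hS : i ∈ S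
    · have := key (S.erase i) (notMem_erase i S)
      rw [insert_erase hS] at this
      simp only [hS, if_true]
      rw [this]; ring
    · simp only [hS, if_false]
      rw [key S hS]; ring
  · intro S _ _
    by_cases hS : i ∈ S
    · simp only [hS, if_true]
      intro h
      rw [← h] at hS
      exact notMem_erase i S hS
    · simp only [hS, if_false]
      intro h
      exact hS (h ▸ mem_insert_self i S)
  · intro S _; exact mem_univ _
  · intro S _
    by_cases hS : i ∈ S
    · simp [hS]
    · simp [hS]

open Finset in
lemma obs_polar {F V : Type*} [AddCommGroup F] [Module ℝ F] [AddCommGroup V] [Module ℝ V]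
    {r : ℕ} (C : MultilinearMap ℝ (fun _ : Fin r => V) F)
    (hC : ∀ (σ : Equiv.Perm (Fin r)) (v : Fin r → V), C (v ∘ σ) = C v)
    (v : Fin r → V) (h : ∀ S : Finset (Fin r), C (fun _ => ∑ i ∈ S, v i) = 0) : C v = 0 := by
  classical
  have h1 : ∀ S : Finset (Fin r), C (fun _ => ∑ i ∈ S, v i)
      = ∑ f : Fin r → Fin r, (if ∀ j, f j ∈ S then (1 : ℝ) else 0) • C (v ∘ f) := by
    intro S
    rw [C.map_sum_finset (fun _ i => v i) (fun _ => S)]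
    simp only [ite_smul, one_smul, zero_smul]
    rw [← Finset.sum_filter]
    refine Finset.sum_congr ?_ (fun _ _ => rfl)
    ext f
    simp [Fintype.mem_piFinset]
  have h2 : ∑ S : Finset (Fin r), (-1 : ℝ) ^ #S • C (fun _ => ∑ i ∈ S, v i) = 0 := by
    simp [h]
  simp only [h1, Finset.smul_sum, smul_smul] at h2
  rw [Finset.sum_comm] at h2
  simp only [← Finset.sum_smul, mul_ite, mul_one, mul_zero] at h2
  have h3 : ∀ f : Fin r → Fin r,
      (∑ S : Finset (Fin r), (if ∀ j, f j ∈ S then (-1 : ℝ) ^ #S else 0)) • C (v ∘ f)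
       = (if Function.Bijective f then (-1 : ℝ) ^ r else 0) • C v := by
    intro f
    by_cases hf : Function.Bijective f
    · have e : ∀ S : Finset (Fin r), (∀ j, f j ∈ S) ↔ S = univ := by
        intro S
        rw [Finset.eq_univ_iff_forall]
        exact (hf.2.forall (p := fun x => x ∈ S)).symm
      have e2 : C (v ∘ f) = C v := hC (Equiv.ofBijective f hf) v
      rw [if_pos hf, e2]
      simp [e]
    · rw [obs_alt f hf, if_neg hf, zero_smul, zero_smul]
  rw [Finset.sum_congr rfl (fun f _ => h3 f), ← Finset.sum_smul, ← Finset.sum_filter,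
    Finset.sum_const, nsmul_eq_mul] at h2
  rcases smul_eq_zero.1 h2 with h4 | h4
  · exfalso
    rcases mul_eq_zero.1 h4 with h5 | h5
    · have h6 : #{f : Fin r → Fin r | Function.Bijective f} = 0 := by exact_mod_cast h5
      rw [Finset.card_eq_zero] at h6
      have : (id : Fin r → Fin r) ∈ ({f : Fin r → Fin r | Function.Bijective f} : Finset _) := by
        exact Finset.mem_filter.2 ⟨mem_univ _, Function.bijective_id⟩
      rw [h6] at this
      simp at this
    · exact absurd h5 (by simp)
  · exact h4

/-- A convex cone inside the open future cone. -/
def obsCone (n : ℕ) (w : Fin (n + 1) → ℝ) : Prop := ∑ i : Fin n, |w i.succ| < w 0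

lemma obsCone_add {n : ℕ} {v w : Fin (n + 1) → ℝ} (hv : obsCone n v) (hw : obsCone n w) :
    obsCone n (v + w) := by
  unfold obsCone at *
  calc ∑ i : Fin n, |(v + w) i.succ| ≤ ∑ i : Fin n, (|v i.succ| + |w i.succ|) :=
        Finset.sum_le_sum (fun i _ => abs_add_le _ _)
    _ = ∑ i : Fin n, |v i.succ| + ∑ i : Fin n, |w i.succ| := Finset.sum_add_distrib
    _ < (v + w) 0 := by simp only [Pi.add_apply]; linarith

lemma obsCone_decomp {n : ℕ} (v : Fin (n + 1) → ℝ) :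
    ∃ x y, obsCone n x ∧ obsCone n y ∧ v = x - y := by
  set c : ℝ := 1 + |v 0| + ∑ i : Fin n, |v i.succ| with hc
  have h0 : 0 ≤ ∑ i : Fin n, |v i.succ| := Finset.sum_nonneg (fun _ _ => abs_nonneg _)
  have h1 := neg_abs_le (v 0)
  have h2 := abs_nonneg (v 0)
  refine ⟨v + Pi.single 0 c, Pi.single 0 c, ?_, ?_, by simp⟩
  · simp [obsCone]; linarith
  · simp [obsCone]; linarith

lemma obs_zero {F : Type*} [AddCommGroup F] [Module ℝ F] {n r : ℕ}
    (C : MultilinearMap ℝ (fun _ : Fin r => (Fin (n + 1) → ℝ)) F)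
    (hC : ∀ (σ : Equiv.Perm (Fin r)) (v : Fin r → (Fin (n + 1) → ℝ)), C (v ∘ σ) = C v)
    (h : ∀ u : Fin (n + 1) → ℝ, minkowski n u u = -1 → 0 < u 0 → C (fun _ => u) = 0)
    (v : Fin r → (Fin (n + 1) → ℝ)) : C v = 0 := by
  classical
  have hK : ∀ w, obsCone n w → C (fun _ => w) = 0 := by
    intro w hw
    unfold obsCone at hw
    have h0 : 0 ≤ ∑ i : Fin n, |w i.succ| := Finset.sum_nonneg (fun _ _ => abs_nonneg _)
    have h1 : ∑ i : Fin n, |w i.succ| ^ 2 ≤ (∑ i : Fin n, |w i.succ|) ^ 2 := by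
      rw [sq (∑ i : Fin n, |w i.succ|), Finset.sum_mul]
      refine Finset.sum_le_sum (fun i _ => ?_)
      rw [sq]
      exact mul_le_mul_of_nonneg_left (Finset.single_le_sum (f := fun i : Fin n => |w i.succ|)
        (fun _ _ => abs_nonneg _) (Finset.mem_univ i)) (abs_nonneg _)
    simp only [sq_abs] at h1
    set q := ∑ i : Fin n, w i.succ ^ 2 with hq
    have hpos : 0 < w 0 ^ 2 - q := by nlinarith
    set s := Real.sqrt (w 0 ^ 2 - q) with hs
    have hs0 : 0 < s := Real.sqrt_pos.2 hpos
    have hs2 : s ^ 2 = w 0 ^ 2 - q := Real.sq_sqrt hpos.le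
    have hu := h (s⁻¹ • w) (by
      have : ∑ i : Fin n, (s⁻¹ * w i.succ) * (s⁻¹ * w i.succ) = s⁻¹ ^ 2 * q := by
        rw [hq, Finset.mul_sum]
        exact Finset.sum_congr rfl (fun i _ => by ring)
      simp only [minkowski, Pi.smul_apply, smul_eq_mul, this]
      have h3 : q = w 0 ^ 2 - s ^ 2 := by linarith
      rw [h3]
      field_simp
      ring) (by
      simp only [Pi.smul_apply, smul_eq_mul]
      exact mul_pos (inv_pos.2 hs0) (by linarith))
    rw [C.map_smul_univ (fun _ => s⁻¹) (fun _ => w)] at hu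
    rcases smul_eq_zero.1 hu with h4 | h4
    · simp [hs0.ne'] at h4
    · exact h4
  have hKr : ∀ w : Fin r → (Fin (n + 1) → ℝ), (∀ i, obsCone n (w i)) → C w = 0 := by
    intro w hw
    refine obs_polar C hC w (fun S => ?_)
    rcases S.eq_empty_or_nonempty with rfl | hS
    · rcases Nat.eq_zero_or_pos r with rfl | hr
      · obtain ⟨x, _, hx, _⟩ := obsCone_decomp (n := n) 0
        rw [← hK x hx]
        congr 1
        exact Subsingleton.elim _ _
      · exact C.map_coord_zero ⟨0, hr⟩ (by simp)
    · exact hK _ (Finset.sum_induction_nonempty w (obsCone n) (fun _ _ => obsCone_add) hS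
        (fun i _ => hw i))
  have main : ∀ s : Finset (Fin r), ∀ w : Fin r → (Fin (n + 1) → ℝ),
      (∀ i, i ∉ s → obsCone n (w i)) → C w = 0 := by
    intro s
    induction s using Finset.induction_on with
    | empty => exact fun w hw => hKr w (fun i => hw i (by simp))
    | insert a s ha ih =>
      intro w hw
      obtain ⟨x, y, hx, hy, hxy⟩ := obsCone_decomp (w a)
      have hz : ∀ z, obsCone n z → C (Function.update w a z) = 0 := by
        intro z hz
        refine ih _ (fun i hi => ?_)
        by_cases hia : i = a
        · subst hia; simpa using hz
        · rw [Function.update_of_ne hia]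
          exact hw i (by simp [hia, hi])
      rw [← Function.update_eq_self a w, hxy, C.map_update_sub, hz x hx, hz y hy, sub_zero]
  exact main Finset.univ v (by simp)

/-- Let `F` be a real vector space and `A`, `B` symmetric multilinear maps
of rank `r` on Minkowski space `ℝ^{n+1}` (`n ≥ 1`) with values in `F`.  If
`A(u,…,u) = B(u,…,u)` for every future-pointing timelike unit vector `u` (i.e.
`η(u,u) = −1` and `u₀ > 0`), then `A = B`. -/
theorem observer_principle_future
    {F : Type*} [AddCommGroup F] [Module ℝ F]
    {n : ℕ} (hn : 1 ≤ n) {r : ℕ}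
    (A B : MultilinearMap ℝ (fun _ : Fin r => (Fin (n + 1) → ℝ)) F)
    (hAsym : ∀ (σ : Equiv.Perm (Fin r)) (v : Fin r → (Fin (n + 1) → ℝ)), A (v ∘ σ) = A v)
    (hBsym : ∀ (σ : Equiv.Perm (Fin r)) (v : Fin r → (Fin (n + 1) → ℝ)), B (v ∘ σ) = B v)
    (h : ∀ u : Fin (n + 1) → ℝ, minkowski n u u = -1 → 0 < u 0 →
      A (fun _ => u) = B (fun _ => u)) :
    A = B := by
  refine MultilinearMap.ext fun v => ?_
  have := obs_zero (A - B) (fun σ v => by simp [hAsym, hBsym])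
    (fun u hu hu0 => by simp [h u hu hu0]) v
  exact sub_eq_zero.1 (by simpa using this)
end

section
/- Let n ≥ 1 and let η be the Minkowski form on ℝ^{n+1}. Let S and T be symmetric bilinear forms on ℝ^{n+1}. If S(u,u) = T(u,u) for every timelike unit vector u (i.e., every u with η(u,u) = −1), then S = T. -/
/-- Two symmetric bilinear forms `S`, `T` on Minkowski space `ℝ^{n+1}`
(`n ≥ 1`) agreeing on the diagonal at every timelike unit vector (`η(u,u) = −1`) are
equal. -/
theorem symm_bilinear_eq_of_eq_on_timelike_unit
    {n : ℕ} (hn : 1 ≤ n)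
    (S T : (Fin (n + 1) → ℝ) →ₗ[ℝ] (Fin (n + 1) → ℝ) →ₗ[ℝ] ℝ)
    (hSsym : ∀ v w, S v w = S w v) (hTsym : ∀ v w, T v w = T w v)
    (h : ∀ u : Fin (n + 1) → ℝ, minkowski n u u = -1 → S u u = T u u) :
    S = T := by
  have hscale : ∀ (c : ℝ) (v : Fin (n + 1) → ℝ),
      minkowski n (c • v) (c • v) = c ^ 2 * minkowski n v v := by
    intro c v
    simp only [minkowski, Pi.smul_apply, smul_eq_mul, mul_add, Finset.mul_sum]
    congr 1
    · ring
    · exact Finset.sum_congr rfl fun i _ => by ring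
  -- agreement on all timelike vectors
  have h1 : ∀ v : Fin (n + 1) → ℝ, minkowski n v v < 0 → S v v = T v v := by
    intro v hv
    have hs : 0 < Real.sqrt (-minkowski n v v) := Real.sqrt_pos.mpr (by linarith)
    have hsq : Real.sqrt (-minkowski n v v) ^ 2 = -minkowski n v v :=
      Real.sq_sqrt (by linarith)
    set s := Real.sqrt (-minkowski n v v) with hsdef
    have hu := h (s⁻¹ • v) (by
      rw [hscale, inv_pow, hsq]
      field_simp
      rw [div_self hv.ne])
    simp only [map_smul, LinearMap.smul_apply, smul_eq_mul] at hu
    have hne : s⁻¹ ≠ 0 := inv_ne_zero hs.ne'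
    exact mul_left_cancel₀ hne (mul_left_cancel₀ hne hu)
  set e : Fin (n + 1) → ℝ := Pi.single 0 1 with he
  have hshift : ∀ (v : Fin (n + 1) → ℝ) (t : ℝ),
      minkowski n (v + t • e) (v + t • e) = minkowski n v v - 2 * t * v 0 - t ^ 2 := by
    intro v t
    simp [minkowski, he, Pi.single_apply, Fin.succ_ne_zero]
    ring
  have hee : S e e = T e e := h1 e (by simp [minkowski, he, Pi.single_apply, Fin.succ_ne_zero])
  have h2 : ∀ v, S v v = T v v := by
    intro v
    have key : ∀ t : ℝ, 1 + 2 * |v 0| + |minkowski n v v| ≤ t →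
        S v v + 2 * t * S v e = T v v + 2 * t * T v e := by
      intro t ht
      have a1 := abs_nonneg (v 0)
      have a2 := neg_abs_le (v 0)
      have a3 := le_abs_self (minkowski n v v)
      have a4 := abs_nonneg (minkowski n v v)
      have := h1 (v + t • e) (by
        rw [hshift]
        have b1 : 0 ≤ t * (v 0 + |v 0|) := mul_nonneg (by linarith) (by linarith)
        have b2 : 0 ≤ t * (t - (1 + 2 * |v 0| + |minkowski n v v|)) :=
          mul_nonneg (by linarith) (by linarith)
        have b3 : 0 ≤ (t - 1) * |minkowski n v v| := mul_nonneg (by linarith) a4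
        nlinarith)
      simp only [map_add, map_smul, LinearMap.add_apply, LinearMap.smul_apply,
        smul_eq_mul] at this
      rw [hSsym e v, hTsym e v, hee] at this
      linarith
    set r := 1 + 2 * |v 0| + |minkowski n v v| with hr
    have k1 := key r le_rfl
    have k2 := key (r + 1) (by linarith)
    have hd : S v e = T v e := by linarith
    rw [hd] at k1
    linarith
  refine LinearMap.ext fun v => LinearMap.ext fun w => ?_
  have h3 := h2 (v + w)
  simp only [map_add, LinearMap.add_apply] at h3
  rw [hSsym w v, hTsym w v] at h3
  linarith [h2 v, h2 w]
end

section
/- Let E be a real vector space and F a non-degenerate real vector space (for every nonzero v ∈ F there is a linear functional λ : F → ℝ with λ(v) ≠ 0). For 0 ≤ k ≤ r let A_k be a symmetric multilinear map of rank k from E^k to F (with A₀ a fixed vector of F). If the polynomial function f(x) = Σ_{k=0}^{r} A_k(x,...,x) vanishes identically on a subset U of E whose r-fold iterated star Star^r(U,E) is non-empty, then A_k = 0 for every 1 ≤ k ≤ r and A₀ = 0. -/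
open Polynomial in
/-- The polynomial `t ↦ f (x + t y, …, x + t y)`. -/
noncomputable def linePoly {E : Type*} [AddCommGroup E] [Module ℝ E] {n : ℕ}
    (f : MultilinearMap ℝ (fun _ : Fin n => E) ℝ) (x y : E) : ℝ[X] :=
  ∑ s : Finset (Fin n), C (f (s.piecewise (fun _ => y) (fun _ => x))) * X ^ s.card

theorem linePoly_eval {E : Type*} [AddCommGroup E] [Module ℝ E] {n : ℕ}
    (f : MultilinearMap ℝ (fun _ : Fin n => E) ℝ) (x y : E) (t : ℝ) :
    (linePoly f x y).eval t = f (fun _ => x + t • y) := by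
  have h1 : (fun _ : Fin n => x + t • y) = (fun _ => t • y) + (fun _ => x) := by
    funext i; simp [add_comm]
  rw [h1, f.map_add_univ, linePoly, Polynomial.eval_finsetSum]
  refine Finset.sum_congr rfl fun s _ => ?_
  have h2 := f.map_piecewise_smul (fun _ => t) (s.piecewise (fun _ => y) (fun _ => x)) s
  have h3 : s.piecewise (fun i => t • (s.piecewise (fun _ : Fin n => y) (fun _ => x)) i)
      (s.piecewise (fun _ => y) (fun _ => x)) = s.piecewise (fun _ => t • y) (fun _ => x) := by
    funext i
    by_cases hi : i ∈ s <;> simp [hi]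
  rw [h3] at h2
  rw [h2]
  simp only [Polynomial.eval_mul, Polynomial.eval_C, Polynomial.eval_pow, Polynomial.eval_X,
    Finset.prod_const, Finset.card_univ, Fintype.card_fin, smul_eq_mul]
  exact mul_comm _ _

theorem linePoly_coeff_one {E : Type*} [AddCommGroup E] [Module ℝ E] {n : ℕ}
    (f : MultilinearMap ℝ (fun _ : Fin n => E) ℝ) (x y : E) :
    (linePoly f x y).coeff 1 = ∑ i : Fin n, f (Function.update (fun _ => x) i y) := by
  rw [linePoly, Polynomial.finsetSum_coeff]
  simp_rw [Polynomial.coeff_C_mul_X_pow]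
  rw [← Finset.sum_filter]
  have h : (Finset.univ.filter fun s : Finset (Fin n) => 1 = s.card)
      = Finset.powersetCard 1 Finset.univ := by
    ext s; simp [Finset.mem_powersetCard, eq_comm]
  rw [h, Finset.powersetCard_one, Finset.sum_map]
  simp [Finset.piecewise_singleton]

theorem symm_eq_zero_of_diag {E : Type*} [AddCommGroup E] [Module ℝ E] : ∀ {n : ℕ}
    (f : MultilinearMap ℝ (fun _ : Fin n => E) ℝ)
    (_ : ∀ (σ : Equiv.Perm (Fin n)) (v : Fin n → E), f (v ∘ σ) = f v)
    (_ : ∀ x, f (fun _ => x) = 0), f = 0 := by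
  intro n
  induction n with
  | zero =>
    intro f _ h0
    ext v
    rw [Subsingleton.elim v (fun _ => 0), h0]; rfl
  | succ n ih =>
    intro f hs h0
    have key : ∀ y, f.curryLeft y = 0 := by
      intro y
      apply ih
      · intro σ v
        rw [f.curryLeft_apply, f.curryLeft_apply]
        rw [← hs (Equiv.Perm.decomposeFin.symm (0, σ)) (Fin.cons y v)]
        congr 1
        funext i
        refine Fin.cases ?_ (fun j => ?_) i <;> simp
      · intro x
        have hp : linePoly f x y = 0 := by
          apply Polynomial.funext
          intro t
          rw [linePoly_eval, h0]; simp
        have hc := linePoly_coeff_one f x y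
        rw [hp] at hc
        have he : ∀ i, f (Function.update (fun _ => x) i y) = f (Fin.cons y fun _ => x) := by
          intro i
          rw [← hs (Equiv.swap 0 i) (Fin.cons y fun _ => x)]
          congr 1
          funext j
          by_cases hj : j = i
          · subst hj; simp
          · have : Equiv.swap 0 i j ≠ 0 := by
              intro h
              apply hj
              apply (Equiv.swap 0 i).injective
              simpa using h
            obtain ⟨m, hm⟩ := Fin.exists_succ_eq.mpr this
            simp [hj, ← hm]
        simp only [he, Finset.sum_const, Polynomial.coeff_zero] at hc
        rw [f.curryLeft_apply]
        simp only [Finset.card_univ, Fintype.card_fin, nsmul_eq_mul] at hc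
        have hn : ((n + 1 : ℕ) : ℝ) ≠ 0 := by positivity
        exact (mul_eq_zero.mp hc.symm).resolve_left hn
    ext v
    have := congrArg (fun g => g (Fin.tail v)) (key (v 0))
    simpa [f.curryLeft_apply] using this

theorem starIter_subset {E : Type*} [AddCommGroup E] [Module ℝ E] (k : ℕ) :
    ∀ U : Set E, starIter k U ⊆ U := by
  induction k with
  | zero => intro U; exact subset_rfl
  | succ k ih => intro U; exact (ih _).trans fun _ h => h.1

theorem real_case {E : Type*} [AddCommGroup E] [Module ℝ E] {r : ℕ}
    (A : ∀ k : Fin (r + 1), MultilinearMap ℝ (fun _ : Fin (k : ℕ) => E) ℝ)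
    (hAsym : ∀ (k : Fin (r + 1)) (σ : Equiv.Perm (Fin (k : ℕ))) (v : Fin (k : ℕ) → E),
      A k (v ∘ σ) = A k v)
    (U : Set E) (hstar : (starSet U).Nonempty)
    (hvanish : ∀ x ∈ U, ∑ k : Fin (r + 1), A k (fun _ => x) = 0) :
    ∀ k, A k = 0 := by
  obtain ⟨v0, -, hv⟩ := hstar
  have hall : ∀ x, ∑ k : Fin (r + 1), A k (fun _ => x) = 0 := by
    intro x
    obtain ⟨δ, hδ, hU⟩ := hv (x - v0)
    have hp : ∑ k, linePoly (A k) v0 (x - v0) = 0 := by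
      apply Polynomial.eq_zero_of_infinite_isRoot
      refine (Set.Icc_infinite (show -δ < δ by linarith)).mono fun t ht => ?_
      simp only [Set.mem_ofPred_eq, Polynomial.IsRoot.def, Polynomial.eval_finsetSum,
        linePoly_eval]
      exact hvanish _ (hU t (abs_le.mpr ht))
    have := congrArg (Polynomial.eval 1) hp
    simpa [Polynomial.eval_finsetSum, linePoly_eval] using this
  intro k
  apply symm_eq_zero_of_diag _ (hAsym k)
  intro x
  have hp : ∑ k : Fin (r + 1), Polynomial.C (A k (fun _ => x)) * Polynomial.X ^ (k : ℕ) = 0 := by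
    apply Polynomial.funext
    intro t
    rw [Polynomial.eval_finsetSum, Polynomial.eval_zero, ← hall (t • x)]
    refine Finset.sum_congr rfl fun k _ => ?_
    have := (A k).map_smul_univ (fun _ => t) (fun _ => x)
    rw [this]
    simp only [Polynomial.eval_mul, Polynomial.eval_C, Polynomial.eval_pow, Polynomial.eval_X,
      Finset.prod_const, Finset.card_univ, Fintype.card_fin, smul_eq_mul]
    exact mul_comm _ _
  have hc := congrArg (fun p => Polynomial.coeff p (k : ℕ)) hp
  simp only [Polynomial.finsetSum_coeff, Polynomial.coeff_C_mul_X_pow, Polynomial.coeff_zero,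
    Fin.val_inj] at hc
  simpa using hc

/-- Let `E` be a real vector space and `F` a non-degenerate real vector
space.  For `0 ≤ k ≤ r` let `A k` be a symmetric multilinear map of rank `k` from `E^k` to
`F` (a rank-0 multilinear map being just a vector of `F`).  If the polynomial function
`f(x) = ∑_{k=0}^{r} A_k(x,…,x)` vanishes identically on a subset `U` of `E` whose `r`-fold
iterated star is non-empty, then every `A k` vanishes (in particular `A₀ = 0` and `A_k = 0`
for `1 ≤ k ≤ r`). -/
theorem polynomial_vanishes_on_star_imp_coefficients_zero
    {E F : Type*} [AddCommGroup E] [Module ℝ E] [AddCommGroup F] [Module ℝ F]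
    (hF : ∀ v : F, v ≠ 0 → ∃ l : F →ₗ[ℝ] ℝ, l v ≠ 0)
    {r : ℕ}
    (A : ∀ k : Fin (r + 1), MultilinearMap ℝ (fun _ : Fin (k : ℕ) => E) F)
    (hAsym : ∀ (k : Fin (r + 1)) (σ : Equiv.Perm (Fin (k : ℕ))) (v : Fin (k : ℕ) → E),
      A k (v ∘ σ) = A k v)
    (U : Set E) (hstar : (starIter r U).Nonempty)
    (hvanish : ∀ x ∈ U, ∑ k : Fin (r + 1), A k (fun _ => x) = 0) :
    ∀ k, A k = 0 := by
  intro k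
  rcases r with _ | r
  · obtain ⟨x, hx⟩ := hstar
    have h := hvanish x hx
    rw [Fin.sum_univ_one] at h
    have hk : k = 0 := Fin.ext (by simp)
    subst hk
    ext v
    have hv : v = fun _ => x := by
      funext i; exact i.elim0
    rw [hv, h]; rfl
  · ext v
    by_contra hne
    obtain ⟨l, hl⟩ := hF _ hne
    apply hl
    have := real_case (fun k => l.compMultilinearMap (A k))
      (fun k σ v => by simp [hAsym k σ v]) U
      (hstar.mono (starIter_subset r _))
      (fun x hx => by
        have := congrArg l (hvanish x hx)
        simpa using this) k
    simpa using congrArg (fun g => g v) this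
end

section
/- Let K be a compact topological space, n ≥ 1, and let g : K → (bilinear forms on ℝ^{n+1}) be a continuous family of symmetric bilinear forms (continuity meaning (m, v, w) ↦ g(m)(v,w) is continuous in m for each v, w, equivalently g is continuous into the finite-dimensional space of bilinear forms). Let E be a vector subspace of the space C(K, ℝ^{n+1}) of continuous maps from K to ℝ^{n+1}, and let U be the set of all v ∈ E such that g(m)(v(m), v(m)) < 0 for every m ∈ K. Then Star(U,E) = U. -/
lemma continuous_bilin_aux {K : Type*} [TopologicalSpace K] {k : ℕ}
    (g : K → (Fin k → ℝ) →ₗ[ℝ] (Fin k → ℝ) →ₗ[ℝ] ℝ)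
    (hg : ∀ v w : Fin k → ℝ, Continuous fun m => g m v w)
    (v w : K → Fin k → ℝ) (hv : Continuous v) (hw : Continuous w) :
    Continuous fun m => g m (v m) (w m) := by
  have h : (fun m => g m (v m) (w m)) = fun m => ∑ i, ∑ j,
      v m i * (w m j * g m (Pi.single i 1) (Pi.single j 1)) := by
    funext m
    conv_lhs => rw [pi_eq_sum_univ' (v m), pi_eq_sum_univ' (w m)]
    simp only [map_sum, map_smul, LinearMap.sum_apply, LinearMap.smul_apply, smul_eq_mul,
      Finset.mul_sum]
    rw [Finset.sum_comm]
    refine Finset.sum_congr rfl fun i _ => Finset.sum_congr rfl fun j _ => ?_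
    ring
  rw [h]
  refine continuous_finsetSum _ fun i _ => continuous_finsetSum _ fun j _ => ?_
  exact ((continuous_apply i).comp hv).mul (((continuous_apply j).comp hw).mul (hg _ _))

/-- Let `K` be a compact topological space and `g` a continuous family of
symmetric bilinear forms on `ℝ^{n+1}` parametrized by `K` (`n ≥ 1`).  Let `E` be a vector
subspace of the space `C(K, ℝ^{n+1})` of continuous maps and `U ⊆ E` the set of fields `v`
with `g(m)(v(m),v(m)) < 0` for all `m ∈ K` (the timelike fields).  Then `Star(U,E) = U`. -/
theorem star_of_timelike_fields_eq
    {K : Type*} [TopologicalSpace K] [CompactSpace K]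
    {n : ℕ} (hn : 1 ≤ n)
    (g : K → (Fin (n + 1) → ℝ) →ₗ[ℝ] (Fin (n + 1) → ℝ) →ₗ[ℝ] ℝ)
    (hgcont : ∀ v w : Fin (n + 1) → ℝ, Continuous fun m => g m v w)
    (hgsym : ∀ (m : K) (v w : Fin (n + 1) → ℝ), g m v w = g m w v)
    (E : Submodule ℝ C(K, Fin (n + 1) → ℝ)) :
    starSet {v : E | ∀ m : K,
        g m ((v : C(K, Fin (n + 1) → ℝ)) m) ((v : C(K, Fin (n + 1) → ℝ)) m) < 0} =
      {v : E | ∀ m : K,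
        g m ((v : C(K, Fin (n + 1) → ℝ)) m) ((v : C(K, Fin (n + 1) → ℝ)) m) < 0} := by
  refine Set.Subset.antisymm (fun v hv => hv.1) (fun v hv => ⟨hv, fun w => ?_⟩)
  have hv' : ∀ m : K, g m (v.1 m) (v.1 m) < 0 := hv
  have hF : Continuous fun p : ℝ × K =>
      g p.2 (v.1 p.2 + p.1 • w.1 p.2) (v.1 p.2 + p.1 • w.1 p.2) := by
    refine continuous_bilin_aux (fun p : ℝ × K => g p.2)
      (fun a b => (hgcont a b).comp continuous_snd) _ _ ?_ ?_ <;>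
    exact (v.1.continuous.comp continuous_snd).add
      (continuous_fst.smul (w.1.continuous.comp continuous_snd))
  have hev : ∀ᶠ t : ℝ in nhds 0, ∀ m ∈ (Set.univ : Set K),
      g m (v.1 m + t • w.1 m) (v.1 m + t • w.1 m) < 0 := by
    refine isCompact_univ.eventually_forall_of_forall_eventually fun m _ => ?_
    refine hF.continuousAt.eventually_lt continuousAt_const ?_
    simpa using hv' m
  obtain ⟨ε, hε, h⟩ := Metric.eventually_nhds_iff.1 hev
  refine ⟨ε / 2, by positivity, fun t ht m => ?_⟩
  have := h (y := t) (by rw [Real.dist_eq, sub_zero]; linarith) m trivial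
  simpa using this
end

section
/- Let K be a compact topological space, n ≥ 1, and let g : K → (bilinear forms on ℝ^{n+1}) be a continuous family of symmetric bilinear forms. Let E be a vector subspace of C(K, ℝ^{n+1}), and let U = {v ∈ E : g(m)(v(m),v(m)) < 0 for all m ∈ K} be the set of timelike fields in E; assume U is non-empty. Let S and T be symmetric multilinear maps of rank r from E^r to ℝ. If S(v,...,v) = T(v,...,v) for every v ∈ U, then S = T. -/
/-- Polarization: a symmetric multilinear map vanishing on the diagonal at all points
`u + ∑ i ∈ s, y i` vanishes at `y`. -/
theorem polarization_aux {E : Type*} [AddCommGroup E] [Module ℝ E] {r : ℕ}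
    (D : MultilinearMap ℝ (fun _ : Fin r => E) ℝ)
    (hsym : ∀ (σ : Equiv.Perm (Fin r)) (v : Fin r → E), D (v ∘ σ) = D v)
    (u : E) (y : Fin r → E)
    (h : ∀ s : Finset (Fin r), D (fun _ => u + ∑ i ∈ s, y i) = 0) : D y = 0 := by
  classical
  let z : Option (Fin r) → E := fun o => o.elim u y
  have hz : ∀ s : Finset (Fin r), ∑ f : Fin r → Option (Fin r),
      (if ∀ i, f i ∈ Finset.insertNone s then D (fun i => z (f i)) else 0) = 0 := by
    intro s
    have h1 := D.map_sum_finset (fun _ => z) (fun _ => Finset.insertNone s)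
    have h2 : ∑ j ∈ Finset.insertNone s, z j = u + ∑ i ∈ s, y i := by
      rw [Finset.sum_insertNone]; rfl
    rw [h2, h s] at h1
    rw [← Finset.sum_filter, h1]
    apply Finset.sum_congr _ (fun _ _ => rfl)
    ext f
    simp [Fintype.mem_piFinset]
  have key : ∀ f : Fin r → Option (Fin r), ∑ s : Finset (Fin r), (-1 : ℝ) ^ s.card *
      (if ∀ i, f i ∈ Finset.insertNone s then D (fun i => z (f i)) else 0)
      = if (∀ j, ∃ i, f i = some j) then (-1 : ℝ) ^ r * D y else 0 := by
    intro f
    split_ifs with hf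
    · choose k hk using hf
      have hki : Function.Injective k := by
        intro a b hab
        have := hk a
        rw [hab, hk b] at this
        exact (Option.some.inj this).symm
      let e : Equiv.Perm (Fin r) := Equiv.ofBijective k (Finite.injective_iff_bijective.mp hki)
      have hfe : ∀ i, f i = some (e.symm i) := by
        intro i
        have := hk (e.symm i)
        rw [← this]
        congr 1
        exact (e.apply_symm_apply i).symm
      rw [Finset.sum_eq_single Finset.univ]
      · have : D (fun i => z (f i)) = D y := by
          rw [← hsym e.symm y]
          congr 1
          funext i
          rw [hfe]; rfl
        rw [if_pos, this]
        · simp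
        · intro i; rw [hfe]; simp
      · intro s _ hs
        rw [if_neg, mul_zero]
        intro hall
        apply hs
        ext j
        have := hall (k j)
        rw [hk j, Finset.some_mem_insertNone] at this
        simp [this]
      · simp
    · push Not at hf
      obtain ⟨j, hj⟩ := hf
      have hcond : ∀ s : Finset (Fin r), (∀ i, f i ∈ Finset.insertNone (insert j s)) ↔
          (∀ i, f i ∈ Finset.insertNone (s.erase j)) := by
        intro s
        apply forall_congr'
        intro i
        rcases hfi : f i with _ | a
        · simp
        · have : a ≠ j := by rintro rfl; exact hj i hfi
          simp [this]
      refine Finset.sum_involution (fun s _ => if j ∈ s then s.erase j else insert j s)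
        ?_ ?_ ?_ ?_
      · intro s _
        by_cases hjs : j ∈ s
        · have h1 := hcond s
          rw [Finset.insert_eq_of_mem hjs] at h1
          have h2 := Finset.card_erase_add_one hjs
          simp only [hjs, if_true, h1]
          rw [← h2, pow_succ]; ring
        · have h1 := hcond s
          rw [Finset.erase_eq_of_notMem hjs] at h1
          simp only [hjs, if_false, h1]
          rw [Finset.card_insert_of_notMem hjs, pow_succ]; ring
      · intro s _ _ heq
        by_cases hjs : j ∈ s
        · simp only [hjs, if_true] at heq
          rw [← heq] at hjs
          simp at hjs
        · simp only [hjs, if_false] at heq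
          exact hjs (heq ▸ Finset.mem_insert_self j s)
      · simp
      · intro s _
        by_cases hjs : j ∈ s <;> simp [hjs]
  have total : ∑ f : Fin r → Option (Fin r),
      (if (∀ j, ∃ i, f i = some j) then (-1 : ℝ) ^ r * D y else 0) = 0 := by
    rw [← Finset.sum_congr rfl (fun f _ => key f), Finset.sum_comm]
    apply Finset.sum_eq_zero
    intro s _
    rw [← Finset.mul_sum, hz s, mul_zero]
  rw [← Finset.sum_filter, Finset.sum_const, smul_eq_zero] at total
  rcases total with h0 | h0
  · rw [Finset.card_eq_zero] at h0
    have : (fun i : Fin r => some i) ∈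
        Finset.univ.filter (fun f : Fin r → Option (Fin r) => ∀ j, ∃ i, f i = some j) := by
      simp
    rw [h0] at this
    simp at this
  · simpa using h0

/-- Openness of the timelike condition along lines. -/
theorem timelike_eventually {K : Type*} [TopologicalSpace K] [CompactSpace K] {n : ℕ}
    (g : K → (Fin (n + 1) → ℝ) →ₗ[ℝ] (Fin (n + 1) → ℝ) →ₗ[ℝ] ℝ)
    (hgcont : ∀ v w : Fin (n + 1) → ℝ, Continuous fun m => g m v w)
    (v x : C(K, Fin (n + 1) → ℝ)) (hv : ∀ m, g m (v m) (v m) < 0) :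
    ∀ᶠ t : ℝ in nhds 0, ∀ m, g m (v m + t • x m) (v m + t • x m) < 0 := by
  have hcont : ∀ a b : C(K, Fin (n + 1) → ℝ), Continuous fun m => g m (a m) (b m) := by
    intro a b
    have : (fun m => g m (a m) (b m)) = fun m => ∑ i, ∑ j,
        a m i * (b m j * g m (Pi.single i 1) (Pi.single j 1)) := by
      funext m
      conv_lhs => rw [pi_eq_sum_univ' (a m), pi_eq_sum_univ' (b m)]
      simp only [map_sum, LinearMap.sum_apply, map_smul, LinearMap.smul_apply, smul_eq_mul,
        Finset.mul_sum]
      try rw [Finset.sum_comm]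
      try (refine Finset.sum_congr rfl fun i _ => Finset.sum_congr rfl fun j _ => ?_)
      simp only [Pi.single_apply, eq_comm]
      try ring_nf
    rw [this]
    have h1 := hgcont
    refine continuous_finsetSum _ fun i _ => continuous_finsetSum _ fun j _ => ?_
    exact ((continuous_apply i).comp a.continuous).mul
      (((continuous_apply j).comp b.continuous).mul (hgcont _ _))
  have hφ : Continuous fun p : ℝ × K =>
      g p.2 (v p.2 + p.1 • x p.2) (v p.2 + p.1 • x p.2) := by
    have : (fun p : ℝ × K => g p.2 (v p.2 + p.1 • x p.2) (v p.2 + p.1 • x p.2)) =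
        fun p : ℝ × K => g p.2 (v p.2) (v p.2) + p.1 * g p.2 (v p.2) (x p.2)
          + p.1 * (g p.2 (x p.2) (v p.2) + p.1 * g p.2 (x p.2) (x p.2)) := by
      funext p
      simp only [map_add, map_smul, LinearMap.add_apply, LinearMap.smul_apply, smul_eq_mul]
      ring
    rw [this]
    have c1 := (hcont v v).comp (continuous_snd : Continuous (Prod.snd : ℝ × K → K))
    have c2 := (hcont v x).comp (continuous_snd : Continuous (Prod.snd : ℝ × K → K))
    have c3 := (hcont x v).comp (continuous_snd : Continuous (Prod.snd : ℝ × K → K))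
    have c4 := (hcont x x).comp (continuous_snd : Continuous (Prod.snd : ℝ × K → K))
    exact (c1.add (continuous_fst.mul c2)).add
      (continuous_fst.mul (c3.add (continuous_fst.mul c4)))
  have := isCompact_univ (X := K).eventually_forall_of_forall_eventually (x₀ := (0 : ℝ))
    (P := fun t m => g m (v m + t • x m) (v m + t • x m) < 0) (by
      intro m _
      refine (hφ.tendsto (0, m)).eventually (gt_mem_nhds ?_)
      simpa using hv m)
  simpa using this

/-- Let `K` be a compact topological space and `g` a continuous family of
symmetric bilinear forms on `ℝ^{n+1}` parametrized by `K` (`n ≥ 1`).  Let `E` be a vector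
subspace of `C(K, ℝ^{n+1})`, and let `U` be the (non-empty) set of timelike fields in `E`.
If `S` and `T` are symmetric multilinear maps of rank `r` from `E^r` to `ℝ` with
`S(v,…,v) = T(v,…,v)` for every `v ∈ U`, then `S = T`. -/
theorem timelike_observer_principle
    {K : Type*} [TopologicalSpace K] [CompactSpace K]
    {n : ℕ} (hn : 1 ≤ n)
    (g : K → (Fin (n + 1) → ℝ) →ₗ[ℝ] (Fin (n + 1) → ℝ) →ₗ[ℝ] ℝ)
    (hgcont : ∀ v w : Fin (n + 1) → ℝ, Continuous fun m => g m v w)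
    (hgsym : ∀ (m : K) (v w : Fin (n + 1) → ℝ), g m v w = g m w v)
    (E : Submodule ℝ C(K, Fin (n + 1) → ℝ))
    (U : Set E)
    (hU : U = {v : E | ∀ m : K,
        g m ((v : C(K, Fin (n + 1) → ℝ)) m) ((v : C(K, Fin (n + 1) → ℝ)) m) < 0})
    (hUne : U.Nonempty)
    {r : ℕ}
    (S T : MultilinearMap ℝ (fun _ : Fin r => E) ℝ)
    (hSsym : ∀ (σ : Equiv.Perm (Fin r)) (v : Fin r → E), S (v ∘ σ) = S v)
    (hTsym : ∀ (σ : Equiv.Perm (Fin r)) (v : Fin r → E), T (v ∘ σ) = T v)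
    (h : ∀ v ∈ U, S (fun _ => v) = T (fun _ => v)) :
    S = T := by
  have hD : ∀ y, (S - T) y = 0 := by
    intro y
    obtain ⟨u, hu⟩ := hUne
    have hev : ∀ᶠ t : ℝ in nhds 0, ∀ s : Finset (Fin r), u + t • ∑ i ∈ s, y i ∈ U := by
      rw [Filter.eventually_all]
      intro s
      rw [hU] at hu ⊢
      have := timelike_eventually g hgcont u.1 (∑ i ∈ s, y i : E).1 hu
      filter_upwards [this] with t ht
      intro m
      exact ht m
    obtain ⟨t, ht, ht0⟩ := ((hev.filter_mono nhdsWithin_le_nhds).and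
      (self_mem_nhdsWithin : {(0 : ℝ)}ᶜ ∈ nhdsWithin 0 {(0 : ℝ)}ᶜ)).exists
    have hp := polarization_aux (S - T)
      (by intro σ v; simp only [MultilinearMap.sub_apply]; rw [hSsym, hTsym])
      u (fun i => t • y i) (by
        intro s
        have h1 := h _ (ht s)
        rw [Finset.smul_sum] at h1
        rw [MultilinearMap.sub_apply, h1, sub_self])
    rw [MultilinearMap.map_smul_univ (S - T) (fun _ => t) y] at hp
    rw [smul_eq_zero] at hp
    rcases hp with h0 | h0
    · simp at h0
      exact absurd h0.1 ht0
    · exact h0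
  ext y
  have := hD y
  rw [MultilinearMap.sub_apply] at this
  linarith
end
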